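/- arXiv:2311.05116 — 2 statements merged into one kernel-verified Lean document; each statement's English description precedes it below -/
import Mathlib

section
/- Let n, N ≥ 1 and d ≥ 1 be integers, c > 0, and let p : ℝ^n → ℝ^N be a polynomial map of degree at most d. Set V = im(p) ∩ {x ∈ ℝ^N : ‖x‖ ≤ c}. Then for every ε with 0 < ε ≤ diam(V), there exists a finite subset F ⊆ V of cardinality at most 2·(4d)^{n+1}·(2·c·n·N^{3/2}/ε)^n such that every point of V lies within Euclidean distance ε of some point of F. -/
/-- The polynomial map `ℝ^n → ℝ^N` whose coordinate functions are the
polynomials `P i`. -/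
noncomputable def polyMap {n N : ℕ} (P : Fin N → MvPolynomial (Fin n) ℝ)
    (x : Fin n → ℝ) : EuclideanSpace ℝ (Fin N) :=
  WithLp.toLp 2 (fun i => MvPolynomial.eval x (P i))

open MvPolynomial

theorem MvPolynomial.hasDerivAt_eval_update {n : ℕ} (p : MvPolynomial (Fin n) ℝ) (x : Fin n → ℝ)
    (i : Fin n) (t : ℝ) :
    HasDerivAt (fun t => eval (Function.update x i t) p)
      (eval (Function.update x i t) (pderiv i p)) t := by
  induction p using MvPolynomial.induction_on with
  | C a => simpa using hasDerivAt_const t a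
  | add p q hp hq => simpa using hp.fun_add hq
  | mul_X p j hp =>
    have hX : HasDerivAt (fun t => Function.update x i t j) ((Pi.single i 1 : Fin n → ℝ) j) t :=
      hasDerivAt_pi.1 (hasDerivAt_update x i t) j
    have h := hp.fun_mul hX
    simp only [map_mul, eval_X]
    refine h.congr_deriv ?_
    by_cases hj : j = i
    · subst hj; simp; ring
    · simp [pderiv_X_of_ne hj, hj]; ring

theorem MvPolynomial.eval_pderiv_eq_zero_of_isLocalMax {n : ℕ} (p : MvPolynomial (Fin n) ℝ)
    {x : Fin n → ℝ} (h : IsLocalMax (fun y => eval y p) x) (i : Fin n) :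
    eval x (pderiv i p) = 0 := by
  have hd := hasDerivAt_eval_update p x i (x i)
  rw [Function.update_eq_self] at hd
  refine IsLocalMax.hasDerivAt_eq_zero ?_ hd
  have hc : Filter.Tendsto (fun t => Function.update x i t) (nhds (x i)) (nhds x) := by
    simpa using (hasDerivAt_update x i (x i)).continuousAt.tendsto
  filter_upwards [hc.eventually h] with t ht
  simpa using ht

theorem MvPolynomial.totalDegree_pderiv_lt {n m : ℕ} {p : MvPolynomial (Fin n) ℝ}
    (hm : 0 < m) (hp : p.totalDegree ≤ m) (i : Fin n) : (pderiv i p).totalDegree < m := by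
  classical
  refine (Finset.sup_lt_iff hm).2 fun s hs => ?_
  have hs' : s + Finsupp.single i 1 ∈ p.support := by
    rw [mem_support_iff] at hs ⊢
    rw [coeff_pderiv] at hs
    exact fun h => hs (by simp [h])
  have := (le_totalDegree hs').trans hp
  rw [Finsupp.sum_add_index' (by simp) (by simp)] at this
  simp at this
  omega

/-- Every function on a finite subset of `ℝ^n` is interpolated by a polynomial. -/
theorem MvPolynomial.exists_eval_eq_of_finset {n : ℕ} (Z : Finset (Fin n → ℝ)) (f : Z → ℝ) :
    ∃ p : MvPolynomial (Fin n) ℝ, ∀ z : Z, eval z.1 p = f z := by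
  classical
  have hsep : ∀ z w : Z, ∃ l : MvPolynomial (Fin n) ℝ,
      eval w.1 l = 0 ∧ (z ≠ w → eval z.1 l = 1) := by
    intro z w
    by_cases h : z = w
    · exact ⟨0, by simp, fun h' => absurd h h'⟩
    · obtain ⟨i, hi⟩ := Function.ne_iff.1 (fun h' => h (Subtype.ext h'))
      refine ⟨C (z.1 i - w.1 i)⁻¹ * (X i - C (w.1 i)), by simp, fun _ => ?_⟩
      simp [inv_mul_cancel₀ (sub_ne_zero.2 hi)]
  choose l hl0 hl1 using hsep
  refine ⟨∑ z, C (f z) * ∏ w ∈ Finset.univ.erase z, l z w, fun z => ?_⟩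
  rw [map_sum, Finset.sum_eq_single z]
  · rw [map_mul, eval_C, map_prod, Finset.prod_eq_one, mul_one]
    intro w hw
    exact hl1 z w (Finset.ne_of_mem_erase hw).symm
  · intro z' _ hz'
    rw [map_mul, map_prod, Finset.prod_eq_zero (i := z), mul_zero]
    · simpa using hz'.symm
    · exact hl0 z' z
  · simp

/-- A Bézout bound: `n` equations `g i + a * X i ^ m = 0` with `deg (g i) < m` have at most
`m ^ n` common solutions in `ℝ^n`. -/
theorem card_commonZeros_le {n m : ℕ} {a : ℝ} (ha : a ≠ 0) (g : Fin n → MvPolynomial (Fin n) ℝ)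
    (hg : ∀ i, (g i).totalDegree < m) (Z : Finset (Fin n → ℝ))
    (hZ : ∀ z ∈ Z, ∀ i, eval z (g i) + a * z i ^ m = 0) : Z.card ≤ m ^ n := by
  classical
  let b : (Fin n → Fin m) → Z → ℝ := fun e z => ∏ i, z.1 i ^ (e i : ℕ)
  have key : ∀ D : ℕ, ∀ p : MvPolynomial (Fin n) ℝ, p.totalDegree ≤ D →
      (fun z : Z => eval z.1 p) ∈ Submodule.span ℝ (Set.range b) := by
    intro D
    induction D using Nat.strong_induction_on with
    | _ D ih =>
      intro p hp
      have hsum : (fun z : Z => eval z.1 p) =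
          ∑ s ∈ p.support, fun z : Z => eval z.1 (monomial s (coeff s p)) := by
        ext z
        rw [Finset.sum_apply, ← map_sum, support_sum_monomial_coeff]
      rw [hsum]
      refine Submodule.sum_mem _ fun s hs => ?_
      by_cases hsm : ∀ i, s i < m
      · have : (fun z : Z => eval z.1 (monomial s (coeff s p))) =
            coeff s p • b fun i => ⟨s i, hsm i⟩ := by
          ext z
          simp [b, eval_monomial, Finsupp.prod_fintype]
        rw [this]
        exact Submodule.smul_mem _ _ (Submodule.subset_span ⟨_, rfl⟩)
      · push Not at hsm
        obtain ⟨i, hi⟩ := hsm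
        obtain ⟨s', rfl⟩ : ∃ s', s = s' + Finsupp.single i m :=
          ⟨s - Finsupp.single i m, (tsub_add_cancel_of_le (by simpa using hi)).symm⟩
        set c := coeff (s' + Finsupp.single i m) p
        have hdeg : (monomial s' (-a⁻¹ * c) * g i).totalDegree < D := by
          have h1 := totalDegree_mul (monomial s' (-a⁻¹ * c)) (g i)
          have h2 := totalDegree_monomial_le s' (-a⁻¹ * c)
          have h3 := (le_totalDegree hs).trans hp
          rw [Finsupp.sum_add_index' (by simp) (by simp)] at h3
          simp only [Finsupp.sum_single_index] at h3
          have h4 := hg i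
          have h5 : (s'.sum fun _ => id) = s'.sum fun _ e => e := rfl
          omega
        convert ih _ hdeg _ le_rfl using 1
        ext z
        have hz := hZ z.1 z.2 i
        have hX : z.1 i ^ m = -a⁻¹ * eval z.1 (g i) := by
          field_simp
          linarith
        rw [show monomial (s' + Finsupp.single i m) c = monomial s' c * X i ^ m by
          rw [X_pow_eq_monomial, monomial_mul, mul_one]]
        simp only [map_mul, map_pow, eval_X, hX, eval_monomial]
        ring
  have htop : Submodule.span ℝ (Set.range b) = ⊤ := by
    refine Submodule.eq_top_iff'.2 fun f => ?_
    obtain ⟨p, hp⟩ := exists_eval_eq_of_finset Z f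
    rw [← funext hp]
    exact key _ p le_rfl
  have hcard := finrank_range_le_card (R := ℝ) b
  rw [Set.finrank, htop, finrank_top] at hcard
  simpa using hcard

/-- A Warren-type bound on the number of strict sign patterns realised by finitely many real
polynomials of degree at most `d`. -/
theorem card_signPatterns_le {n d : ℕ} {ι : Type*} [Fintype ι]
    (f : ι → MvPolynomial (Fin n) ℝ) (hf : ∀ k, (f k).totalDegree ≤ d)
    (S : Finset (Fin n → ℝ)) (hne : ∀ x ∈ S, ∀ k, eval x (f k) ≠ 0)
    (hsep : ∀ x ∈ S, ∀ y ∈ S, x ≠ y → ∃ k, eval x (f k) * eval y (f k) < 0) :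
    S.card ≤ (2 * d * Fintype.card ι + 2) ^ n := by
  classical
  set m := 2 * d * Fintype.card ι + 2 with hm
  let r : (Fin n → ℝ) → ℝ := fun x => ∑ i, x i ^ 2
  obtain ⟨R, hR⟩ : ∃ R, ∀ x ∈ S, r x < R := by
    obtain ⟨R, hR⟩ := (S.image r).bddAbove
    exact ⟨R + 1, fun x hx => (hR (by simpa using ⟨x, hx, rfl⟩)).trans_lt (lt_add_one R)⟩
  let F : MvPolynomial (Fin n) ℝ := (C R - ∑ i, X i ^ 2) * ∏ k, f k ^ 2
  have hFeval : ∀ x, eval x F = (R - r x) * ∏ k, eval x (f k) ^ 2 := by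
    intro x; simp [F, r, map_prod]
  have hFdeg : F.totalDegree ≤ m := by
    have h1 : (C R - ∑ i, X i ^ 2 : MvPolynomial (Fin n) ℝ).totalDegree ≤ 2 := by
      refine (totalDegree_sub _ _).trans (max_le (by simp) ?_)
      exact totalDegree_finsetSum_le fun i _ => by simp
    have h2 : (∏ k, f k ^ 2).totalDegree ≤ ∑ _k : ι, 2 * d :=
      (totalDegree_finsetProd _ _).trans <| Finset.sum_le_sum fun k _ =>
        (totalDegree_pow _ _).trans (Nat.mul_le_mul_left 2 (hf k))
    have h3 := totalDegree_mul (C R - ∑ i, X i ^ 2 : MvPolynomial (Fin n) ℝ) (∏ k, f k ^ 2)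
    simp only [Finset.sum_const, Finset.card_univ, smul_eq_mul] at h2
    rw [mul_comm] at h2
    exact h3.trans (by omega)
  have hFpos : ∀ x ∈ S, 0 < eval x F := by
    intro x hx
    rw [hFeval]
    exact mul_pos (sub_pos.2 (hR x hx))
      (Finset.prod_pos fun k _ => sq_pos_of_ne_zero (hne x hx k))
  obtain ⟨η, hη, hηF⟩ : ∃ η > 0, ∀ x ∈ S, η ≤ eval x F := by
    rcases S.eq_empty_or_nonempty with rfl | hS
    · exact ⟨1, one_pos, by simp⟩
    · obtain ⟨x₀, hx₀, hmin⟩ := S.exists_min_image (fun x => eval x F) hS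
      exact ⟨_, hFpos x₀ hx₀, hmin⟩
  have hrc : Continuous r := by fun_prop
  have hball : IsCompact {x | r x ≤ R} := by
    refine Metric.isCompact_of_isClosed_isBounded (isClosed_le hrc continuous_const) ?_
    refine (Metric.isBounded_closedBall (x := (0 : Fin n → ℝ)) (r := √R)).subset fun x hx => ?_
    rw [mem_closedBall_zero_iff, pi_norm_le_iff_of_nonneg (Real.sqrt_nonneg R)]
    intro i
    refine Real.abs_le_sqrt (le_trans ?_ hx)
    exact Finset.single_le_sum (f := fun i => x i ^ 2) (fun i _ => sq_nonneg _) (Finset.mem_univ i)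
  let q : MvPolynomial (Fin n) ℝ := ∑ i, X i ^ (m + 1)
  obtain ⟨Q, hQ⟩ := hball.exists_bound_of_continuousOn (continuous_eval q).continuousOn
  obtain ⟨δ, hδ, hδq⟩ : ∃ δ > 0, ∀ x, r x ≤ R → |δ * eval x q| < η / 2 := by
    refine ⟨η / (2 * (|Q| + 1)), by positivity, fun x hx => ?_⟩
    have h1 : |eval x q| < |Q| + 1 := (hQ x hx).trans_lt (by linarith [le_abs_self Q])
    rw [abs_mul, abs_of_pos (by positivity)]
    calc _ < η / (2 * (|Q| + 1)) * (|Q| + 1) := by gcongr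
      _ = η / 2 := by field_simp
  let h : MvPolynomial (Fin n) ℝ := F + C δ * q
  have hcrit : ∀ x : S, ∃ z, (∀ i, eval z (pderiv i h) = 0) ∧
      ∀ k, 0 < eval z (f k) * eval x.1 (f k) := by
    rintro ⟨x, hx⟩
    let A : Set (Fin n → ℝ) := {z | r z ≤ R} ∩ {z | ∀ k, 0 ≤ eval z (f k) * eval x (f k)}
    let U : Set (Fin n → ℝ) := {z | r z < R} ∩ {z | ∀ k, 0 < eval z (f k) * eval x (f k)}
    have hfc : ∀ k, Continuous fun z => eval z (f k) * eval x (f k) := fun k =>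
      (continuous_eval (f k)).mul continuous_const
    have hA : IsCompact A := hball.inter_right <| by
      simp only [Set.ofPred_forall]
      exact isClosed_iInter fun k => isClosed_le continuous_const (hfc k)
    have hU : IsOpen U := (isOpen_lt hrc continuous_const).inter <| by
      simp only [Set.ofPred_forall]
      exact isOpen_iInter_of_finite fun k => isOpen_lt continuous_const (hfc k)
    have hxA : x ∈ A := ⟨(hR x hx).le, fun k => mul_self_nonneg _⟩
    obtain ⟨z, hzA, hz⟩ := hA.exists_isMaxOn ⟨x, hxA⟩ (continuous_eval h).continuousOn
    have hh : ∀ y, eval y h = eval y F + δ * eval y q := by intro y; simp [h]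
    have hFz : 0 < eval z F := by
      have h1 : eval x h ≤ eval z h := hz hxA
      rw [hh, hh] at h1
      linarith [hηF x hx, (abs_lt.1 (hδq x hxA.1)).1, (abs_lt.1 (hδq z hzA.1)).2]
    rw [hFeval] at hFz
    have hzU : U ∈ nhds z := by
      refine hU.mem_nhds ⟨?_, fun k => ?_⟩
      · refine lt_of_le_of_ne (show r z ≤ R from hzA.1) fun h0 => ?_
        simp [h0] at hFz
      · refine lt_of_le_of_ne (hzA.2 k) (Ne.symm (mul_ne_zero (fun h0 => ?_) (hne x hx k)))
        rw [Finset.prod_eq_zero (Finset.mem_univ k) (by rw [h0]; simp), mul_zero] at hFz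
        exact hFz.false
    refine ⟨z, fun i => eval_pderiv_eq_zero_of_isLocalMax h ?_ i, (mem_of_mem_nhds hzU).2⟩
    exact hz.isLocalMax (Filter.mem_of_superset hzU fun y hy =>
      ⟨(show r y < R from hy.1).le, fun k => (hy.2 k).le⟩)
  choose z hz0 hzpos using hcrit
  have hinj : Function.Injective z := by
    intro x y hxy
    by_contra hne'
    obtain ⟨k, hk⟩ := hsep x.1 x.2 y.1 y.2 (fun h' => hne' (Subtype.ext h'))
    have h1 := hzpos x k
    have h2 := hzpos y k
    rw [hxy] at h1
    nlinarith [mul_pos h1 h2, sq_nonneg (eval (z y) (f k))]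
  have hcardS : (Finset.univ.image z).card = S.card := by
    rw [Finset.card_image_of_injective _ hinj]; simp
  rw [← hcardS]
  refine card_commonZeros_le (a := δ * (m + 1)) (by positivity) (fun i => pderiv i F)
    (fun i => totalDegree_pderiv_lt (by omega) hFdeg i) _ ?_
  intro w hw i
  obtain ⟨x, -, rfl⟩ := Finset.mem_image.1 hw
  have := hz0 x i
  have hq : pderiv i q = C ((m : ℝ) + 1) * X i ^ m := by
    simp only [q, map_sum]
    rw [Finset.sum_eq_single i]
    · simp
    · intro j _ hj; simp [pderiv_X_of_ne hj]
    · simp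
  simp only [h, map_add, pderiv_C_mul, hq, map_mul, map_pow, eval_X, eval_C] at this
  linarith

/-- A set whose `ε`-separated finite subsets have at most `B` points has an `ε`-separated
`ε`-net. -/
theorem exists_separated_net {α : Type*} [PseudoMetricSpace α] (V : Set α) {ε : ℝ} (hε : 0 ≤ ε) (B : ℕ)
    (hB : ∀ F : Finset α, ↑F ⊆ V → (F : Set α).Pairwise (fun x y => ε < dist x y) → F.card ≤ B) :
    ∃ F : Finset α, ↑F ⊆ V ∧ (F : Set α).Pairwise (fun x y => ε < dist x y) ∧
      ∀ x ∈ V, ∃ y ∈ F, dist x y ≤ ε := by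
  classical
  let p : ℕ → Prop := fun k => ∃ F : Finset α, ↑F ⊆ V ∧
    (F : Set α).Pairwise (fun x y => ε < dist x y) ∧ F.card = k
  have h0 : p 0 := ⟨∅, by simp, by simp, rfl⟩
  obtain ⟨F, hFV, hFs, hFc⟩ := Nat.findGreatest_spec (Nat.zero_le B) h0
  refine ⟨F, hFV, hFs, fun x hx => ?_⟩
  by_contra! hcon
  have hxF : x ∉ F := fun h => (hcon x h).not_ge (by simpa using hε)
  have hV' : ↑(insert x F) ⊆ V := by
    rw [Finset.coe_insert]
    exact Set.insert_subset hx hFV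
  have hs' : (↑(insert x F) : Set α).Pairwise (fun x y => ε < dist x y) := by
    rw [Finset.coe_insert]
    refine hFs.insert fun y hy _ => ⟨hcon y hy, ?_⟩
    rw [dist_comm]
    exact hcon y hy
  have := Nat.le_findGreatest (P := p) (hB _ hV' hs') ⟨_, hV', hs', rfl⟩
  rw [Finset.card_insert_of_notMem hxF, hFc] at this
  omega

/-- Two points of `[-c, c]` at distance more than `s` are separated by one of the thresholds
`θ + k * s - c`. -/
theorem exists_threshold_between {c s θ a b : ℝ} (hs : 0 < s) (hθ0 : 0 < θ) (hθs : θ < s)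
    (ha : -c ≤ a) (hb : b ≤ c) (hab : a + s < b) :
    ∃ k < ⌊2 * c / s⌋₊ + 1, a < θ + k * s - c ∧ θ + k * s - c < b := by
  have h0 : 0 ≤ ⌊(a + c - θ) / s⌋ + 1 := by
    have : (-1 : ℤ) ≤ ⌊(a + c - θ) / s⌋ := by
      rw [Int.le_floor, le_div_iff₀ hs]
      push_cast
      linarith
    omega
  obtain ⟨k, hk⟩ := Int.eq_ofNat_of_zero_le h0
  have hk' : (k : ℝ) = ⌊(a + c - θ) / s⌋ + 1 := by exact_mod_cast hk.symm
  have h1 : (a + c - θ) / s < k := hk' ▸ Int.lt_floor_add_one _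
  have h2 : (k : ℝ) - 1 ≤ (a + c - θ) / s := by
    rw [hk']; simpa using Int.floor_le ((a + c - θ) / s)
  rw [div_lt_iff₀ hs] at h1
  rw [le_div_iff₀ hs] at h2
  refine ⟨k, Nat.lt_succ_of_le (Nat.le_floor ?_), by linarith, by linarith⟩
  rw [le_div_iff₀ hs]
  linarith

theorem card_le_of_separated_polyMap {n N d : ℕ} (hN : 1 ≤ N) {c ε : ℝ} (hε : 0 < ε)
    (P : Fin N → MvPolynomial (Fin n) ℝ) (hdeg : ∀ i, (P i).totalDegree ≤ d)
    (S : Finset (Fin n → ℝ)) (hS : ∀ x ∈ S, ‖polyMap P x‖ ≤ c)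
    (hsep : ∀ x ∈ S, ∀ y ∈ S, x ≠ y → ε < dist (polyMap P x) (polyMap P y)) :
    S.card ≤ (2 * d * (N * (⌊2 * c / (ε / √N)⌋₊ + 1)) + 2) ^ n := by
  classical
  have hN0 : (0 : ℝ) < N := by exact_mod_cast hN
  set s := ε / √N with hs_def
  have hs : 0 < s := by positivity
  set K := ⌊2 * c / s⌋₊ + 1
  obtain ⟨θ, ⟨hθ0, hθs⟩, hθ⟩ := (Set.Ioo_infinite hs).exists_notMem_finset
    ((S ×ˢ (Finset.univ : Finset (Fin N × Fin K))).image
      fun w => eval w.1 (P w.2.1) + c - (w.2.2 : ℕ) * s)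
  let f : Fin N × Fin K → MvPolynomial (Fin n) ℝ := fun w => P w.1 - C (θ + (w.2 : ℕ) * s - c)
  have hf : ∀ x w, eval x (f w) = eval x (P w.1) - (θ + (w.2 : ℕ) * s - c) := by
    intro x w; simp [f]
  have hbound : ∀ x ∈ S, ∀ i, |eval x (P i)| ≤ c := fun x hx i =>
    (PiLp.norm_apply_le (polyMap P x) i).trans (hS x hx)
  have hmain := card_signPatterns_le f
    (fun w => (totalDegree_sub_C_le _ _).trans (hdeg w.1)) S ?_ ?_
  · simpa using hmain
  · intro x hx w h0
    rw [hf] at h0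
    exact hθ (Finset.mem_image.2 ⟨(x, w), by simp [hx], by simp only; linarith⟩)
  · intro x hx y hy hxy
    by_contra! hcon
    have hcoord : ∀ x ∈ S, ∀ y ∈ S,
        (∀ w, 0 ≤ eval x (f w) * eval y (f w)) → ∀ i, eval y (P i) - eval x (P i) ≤ s := by
      intro x hx y hy h i
      by_contra! hlt
      obtain ⟨k, hk, h1, h2⟩ := exists_threshold_between hs hθ0 hθs
        (abs_le.1 (hbound x hx i)).1 (abs_le.1 (hbound y hy i)).2 (by linarith)
      have h3 := h (i, ⟨k, hk⟩)
      rw [hf, hf] at h3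
      exact absurd h3 (not_le.2 (mul_neg_of_neg_of_pos (by simpa using h1) (by simpa using h2)))
    have habs : ∀ i, |eval x (P i) - eval y (P i)| ≤ s := fun i => abs_sub_le_iff.2
      ⟨hcoord y hy x hx (fun w => mul_comm (eval x (f w)) _ ▸ hcon w) i, hcoord x hx y hy hcon i⟩
    refine absurd (hsep x hx y hy hxy) (not_lt.2 ?_)
    rw [EuclideanSpace.dist_eq]
    refine Real.sqrt_le_iff.2 ⟨hε.le, ?_⟩
    calc ∑ i, dist (polyMap P x i) (polyMap P y i) ^ 2 ≤ ∑ _i : Fin N, s ^ 2 :=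
          Finset.sum_le_sum fun i _ => pow_le_pow_left₀ dist_nonneg (habs i) 2
      _ = ε ^ 2 := by
          simp only [Finset.sum_const, Finset.card_univ, Fintype.card_fin, nsmul_eq_mul, hs_def,
            div_pow, Real.sq_sqrt hN0.le]
          field_simp

/-- Covering number bound for the image of a polynomial map of degree at most `d`
intersected with the closed ball of radius `c`: for `0 < ε ≤ diam V` there is an
`ε`-net of cardinality at most `2·(4d)^(n+1)·(2cnN^{3/2}/ε)^n`. -/
theorem covering_image_polyMap (n N d : ℕ)
    (hn : 1 ≤ n) (hN : 1 ≤ N) (hd : 1 ≤ d) (c : ℝ) (hc : 0 < c)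
    (P : Fin N → MvPolynomial (Fin n) ℝ) (hdeg : ∀ i, (P i).totalDegree ≤ d)
    (ε : ℝ) (hε : 0 < ε)
    (hεd : ε ≤ Metric.diam
      (Set.range (polyMap P) ∩ Metric.closedBall (0 : EuclideanSpace ℝ (Fin N)) c)) :
    ∃ F : Finset (EuclideanSpace ℝ (Fin N)),
      ↑F ⊆ Set.range (polyMap P) ∩ Metric.closedBall (0 : EuclideanSpace ℝ (Fin N)) c ∧
      (F.card : ℝ) ≤ 2 * (4 * d) ^ (n + 1)
          * (2 * c * n * (N : ℝ) ^ ((3 : ℝ) / 2) / ε) ^ n ∧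
      ∀ x ∈ Set.range (polyMap P) ∩ Metric.closedBall (0 : EuclideanSpace ℝ (Fin N)) c,
        ∃ y ∈ F, dist x y ≤ ε := by
  classical
  set V := Set.range (polyMap P) ∩ Metric.closedBall (0 : EuclideanSpace ℝ (Fin N)) c
  have hB : ∀ F : Finset (EuclideanSpace ℝ (Fin N)), ↑F ⊆ V →
      (F : Set (EuclideanSpace ℝ (Fin N))).Pairwise (fun x y => ε < dist x y) →
      F.card ≤ (2 * d * (N * (⌊2 * c / (ε / √N)⌋₊ + 1)) + 2) ^ n := by
    intro F hFV hFs
    have hpre : ∀ y : F, ∃ x, polyMap P x = y.1 := fun y => (hFV y.2).1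
    choose g hg using hpre
    have hginj : Function.Injective g := fun y y' h =>
      Subtype.ext (by rw [← hg y, ← hg y', h])
    have hcard : (Finset.univ.image g).card = F.card := by
      rw [Finset.card_image_of_injective _ hginj]; simp
    rw [← hcard]
    refine card_le_of_separated_polyMap hN hε P hdeg _ ?_ ?_
    · intro x hx
      obtain ⟨y, -, rfl⟩ := Finset.mem_image.1 hx
      rw [hg]
      exact mem_closedBall_zero_iff.1 (hFV y.2).2
    · intro x hx x' hx' hne
      obtain ⟨y, -, rfl⟩ := Finset.mem_image.1 hx
      obtain ⟨y', -, rfl⟩ := Finset.mem_image.1 hx'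
      rw [hg, hg]
      exact hFs y.2 y'.2 fun h => hne (congrArg g (Subtype.ext h))
  obtain ⟨F, hFV, hFs, hnet⟩ := exists_separated_net V hε.le _ hB
  refine ⟨F, hFV, ?_, hnet⟩
  have hcard := hB F hFV hFs
  have hd1 : (1 : ℝ) ≤ d := by exact_mod_cast hd
  have hN1 : (1 : ℝ) ≤ N := by exact_mod_cast hN
  have hsqrt : (1 : ℝ) ≤ √N := Real.one_le_sqrt.2 hN1
  have hε2 : ε ≤ 2 * c := hεd.trans <|
    (Metric.diam_mono Set.inter_subset_right Metric.isBounded_closedBall).trans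
      (Metric.diam_closedBall hc.le)
  have hpow : (N : ℝ) ^ ((3 : ℝ) / 2) = N * √N := by
    rw [Real.sqrt_eq_rpow, ← Real.rpow_one_add' (by positivity) (by norm_num)]
    norm_num
  set T := 2 * c / (ε / √N) with hT_def
  have hT : 1 ≤ T := by
    rw [hT_def, one_le_div (by positivity)]
    exact (div_le_self hε.le hsqrt).trans hε2
  have hX : 2 * c * n * (N : ℝ) ^ ((3 : ℝ) / 2) / ε = n * (N * T) := by
    rw [hpow, hT_def]
    field_simp
  rw [hX]
  have hNT : 1 ≤ N * T := one_le_mul_of_one_le_of_one_le hN1 hT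
  have hdNT : 1 ≤ d * (N * T) := one_le_mul_of_one_le_of_one_le hd1 hNT
  have hfloor : ((⌊T⌋₊ : ℝ)) + 1 ≤ 2 * T := by
    linarith [Nat.floor_le (zero_le_one.trans hT)]
  have hbase : 2 * d * (N * ((⌊T⌋₊ : ℝ) + 1)) + 2 ≤ 6 * (d * (N * T)) := by
    have : 2 * d * (N * ((⌊T⌋₊ : ℝ) + 1)) ≤ 2 * d * (N * (2 * T)) := by gcongr
    linarith
  calc (F.card : ℝ) ≤ (2 * d * (N * ((⌊T⌋₊ : ℝ) + 1)) + 2) ^ n := by exact_mod_cast hcard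
    _ ≤ (6 * (d * (N * T))) ^ n := by gcongr
    _ ≤ 2 * (4 * d) * (4 * d * (n * (N * T))) ^ n := by
        rcases hn.eq_or_lt with rfl | hn2
        · simp only [pow_one, Nat.cast_one]
          nlinarith
        · have hn2' : (2 : ℝ) ≤ n := by exact_mod_cast hn2
          have h1 : 6 * (d * (N * T)) ≤ 4 * d * (n * (N * T)) := by nlinarith
          calc _ ≤ (4 * d * (n * (N * T))) ^ n := by gcongr
            _ ≤ _ := le_mul_of_one_le_left (by positivity) (by linarith)
    _ = 2 * (4 * d) ^ (n + 1) * (n * (N * T)) ^ n := by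
        rw [mul_pow (4 * (d : ℝ)), pow_succ]
        ring
end

section
/- There exists an absolute constant C > 0 with the following property. Let integers 1 ≤ n ≤ N and d ≥ 2, let p : ℝ^n → ℝ^N be a polynomial map of degree at most d, and set V = im(p). Let p̄ ∈ ℝ^N, σ > 0 and 0 < ε ≤ σ, and let x be a random point uniformly distributed on the closed Euclidean ball B(p̄, σ) ⊆ ℝ^N. Then ℙ( dist(x, V) ≤ ε ) ≤ (ε/σ)^{N−n}·2^N·d^{Cn}·N^{Cn}, where dist(x, V) = inf_{v ∈ V} ‖x − v‖. -/
open MeasureTheory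

namespace MvPolynomial

theorem totalDegree_pderiv_le {σ R : Type*} [CommSemiring R] (i : σ) (p : MvPolynomial σ R) :
    (pderiv i p).totalDegree ≤ p.totalDegree := by
  classical
  conv_lhs => rw [p.as_sum, map_sum]
  refine totalDegree_finsetSum_le fun m hm => ?_
  rw [pderiv_monomial]
  refine (totalDegree_monomial_le _ _).trans (le_trans ?_ (le_totalDegree hm))
  exact Finsupp.sum_le_sum_index tsub_le_self (fun _ _ => monotone_id) (fun _ _ => rfl)

theorem hasDerivAt_eval_update_s8 {n : ℕ} (p : MvPolynomial (Fin n) ℝ) (x : Fin n → ℝ) (i : Fin n)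
    (t : ℝ) :
    HasDerivAt (fun s => eval (Function.update x i s) p)
      (eval (Function.update x i t) (pderiv i p)) t := by
  induction p using MvPolynomial.induction_on with
  | C c => simpa using hasDerivAt_const t c
  | add p q hp hq => simpa using hp.fun_add hq
  | mul_X p j hp =>
    have hX : HasDerivAt (fun s => Function.update x i s j) (if j = i then 1 else 0) t := by
      by_cases h : j = i
      · subst h; simpa using hasDerivAt_id' t
      · simpa [h] using hasDerivAt_const t (x j)
    have := hp.mul hX
    simp only [map_mul, eval_X, Derivation.leibniz, pderiv_X, smul_eq_mul, map_add]
    refine this.congr_deriv ?_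
    by_cases h : j = i
    · subst h; simp; ring
    · simp [h]; ring

theorem exists_abs_eval_le {n : ℕ} (p : MvPolynomial (Fin n) ℝ) :
    ∃ (A : ℝ) (k : ℕ), 0 ≤ A ∧ ∀ x : Fin n → ℝ, |eval x p| ≤ A * (1 + ‖x‖) ^ k := by
  induction p using MvPolynomial.induction_on with
  | C c => exact ⟨|c|, 0, abs_nonneg c, fun x => by simp⟩
  | add p q hp hq =>
    obtain ⟨A, k, hA, hp⟩ := hp
    obtain ⟨B, l, hB, hq⟩ := hq
    refine ⟨A + B, k + l, by positivity, fun x => ?_⟩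
    have h1 : (1 : ℝ) ≤ 1 + ‖x‖ := by linarith [norm_nonneg x]
    have hk : (1 + ‖x‖) ^ k ≤ (1 + ‖x‖) ^ (k + l) := pow_le_pow_right₀ h1 (by omega)
    have hl : (1 + ‖x‖) ^ l ≤ (1 + ‖x‖) ^ (k + l) := pow_le_pow_right₀ h1 (by omega)
    calc |eval x (p + q)| ≤ |eval x p| + |eval x q| := by rw [map_add]; exact abs_add_le _ _
      _ ≤ A * (1 + ‖x‖) ^ k + B * (1 + ‖x‖) ^ l := add_le_add (hp x) (hq x)
      _ ≤ (A + B) * (1 + ‖x‖) ^ (k + l) := by rw [add_mul]; gcongr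
  | mul_X p i hp =>
    obtain ⟨A, k, hA, hp⟩ := hp
    refine ⟨A, k + 1, hA, fun x => ?_⟩
    have hx : |x i| ≤ 1 + ‖x‖ := by
      have := norm_le_pi_norm x i
      rw [Real.norm_eq_abs] at this
      linarith
    rw [map_mul, eval_X, abs_mul, pow_succ, ← mul_assoc]
    exact mul_le_mul (hp x) hx (abs_nonneg _) (by positivity)

/-- More polynomials of total degree at most `L` than the size of a box containing all their
exponents are linearly dependent. -/
theorem exists_linear_relation {n L : ℕ} {ι : Type*} [Fintype ι]
    (F : ι → MvPolynomial (Fin n) ℝ) (hF : ∀ i, (F i).totalDegree ≤ L)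
    (hcard : (L + 1) ^ n < Fintype.card ι) :
    ∃ c : ι → ℝ, c ≠ 0 ∧ ∑ i, c i • F i = 0 := by
  let Φ : (ι → ℝ) →ₗ[ℝ] ((Fin n → Fin (L + 1)) → ℝ) :=
    LinearMap.pi fun e =>
      (lcoeff ℝ (Finsupp.equivFunOnFinite.symm fun j => (e j : ℕ))) ∘ₗ
        Fintype.linearCombination ℝ F
  have hker : LinearMap.ker Φ ≠ ⊥ := LinearMap.ker_ne_bot_of_finrank_lt (by simpa using hcard)
  obtain ⟨c, hc, hc0⟩ := (Submodule.ne_bot_iff _).mp hker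
  refine ⟨c, hc0, ?_⟩
  ext m
  rw [coeff_zero]
  have hdeg : (∑ i, c i • F i).totalDegree ≤ L :=
    totalDegree_finsetSum_le fun i _ => (totalDegree_smul_le _ _).trans (hF i)
  by_cases hm : ∀ j, m j < L + 1
  · have := congrFun (LinearMap.mem_ker.mp hc) fun j => ⟨m j, hm j⟩
    have hm' : (Finsupp.equivFunOnFinite.symm fun j => m j) = m := by ext; simp
    simpa [Φ, Fintype.linearCombination_apply, hm', lcoeff] using this
  · push Not at hm
    obtain ⟨j, hj⟩ := hm
    by_contra h
    have h1 := le_totalDegree (mem_support_iff.mpr h)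
    have h2 : m j ≤ m.sum fun _ e => e := by
      rw [Finsupp.sum_fintype _ _ (by simp)]
      exact Finset.single_le_sum (f := fun j => m j) (fun _ _ => Nat.zero_le _) (Finset.mem_univ j)
    omega

/-- The points where the rational map `g / P` takes a generic value `a` have few images under a
given affine function `l`. -/
theorem exists_ne_zero_card_image_le {n E : ℕ} (g : Fin n → MvPolynomial (Fin n) ℝ)
    (P l : MvPolynomial (Fin n) ℝ) (hg : ∀ i, (g i).totalDegree ≤ E) (hP : P.totalDegree ≤ E)
    (hl : l.totalDegree ≤ 1) :
    ∃ q : MvPolynomial (Fin n) ℝ, q ≠ 0 ∧ ∀ a : Fin n → ℝ, eval a q ≠ 0 →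
      ∀ S : Finset (Fin n → ℝ),
        (∀ x ∈ S, eval x P ≠ 0 ∧ ∀ i, eval x (g i) = a i * eval x P) →
        (S.image fun x => eval x l).card ≤ (n * E + 1) ^ n := by
  set B := (n * E + 1) ^ n with hB
  let F : (Fin n → Fin (B + 1)) × Fin (B + 1) → MvPolynomial (Fin n) ℝ := fun r =>
    (∏ i, (g i ^ (r.1 i : ℕ) * P ^ (B - (r.1 i : ℕ)))) * l ^ (r.2 : ℕ)
  have hF : ∀ r, (F r).totalDegree ≤ B * (n * E + 1) := by
    intro r
    have hprod : (∏ i, (g i ^ (r.1 i : ℕ) * P ^ (B - (r.1 i : ℕ)))).totalDegree ≤ n * (B * E) := by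
      refine (totalDegree_finsetProd _ _).trans ?_
      refine (Finset.sum_le_card_nsmul _ _ (B * E) fun i _ => ?_).trans (by simp)
      have hi : (r.1 i : ℕ) ≤ B := Nat.lt_succ_iff.mp (r.1 i).2
      calc _ ≤ (g i ^ (r.1 i : ℕ)).totalDegree + (P ^ (B - (r.1 i : ℕ))).totalDegree :=
            totalDegree_mul _ _
        _ ≤ (r.1 i : ℕ) * E + (B - (r.1 i : ℕ)) * E := by
            refine add_le_add ((totalDegree_pow _ _).trans ?_) ((totalDegree_pow _ _).trans ?_)
            · exact Nat.mul_le_mul_left _ (hg i)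
            · exact Nat.mul_le_mul_left _ hP
        _ = B * E := by rw [← add_mul, Nat.add_sub_cancel' hi]
    have hlpow : (l ^ (r.2 : ℕ)).totalDegree ≤ B :=
      ((totalDegree_pow _ _).trans (Nat.mul_le_mul_left _ hl)).trans
        (by have := r.2.2; omega)
    calc (F r).totalDegree ≤ _ := totalDegree_mul _ _
      _ ≤ n * (B * E) + B := add_le_add hprod hlpow
      _ = B * (n * E + 1) := by ring
  have hcard : (B * (n * E + 1) + 1) ^ n < Fintype.card ((Fin n → Fin (B + 1)) × Fin (B + 1)) := by
    have h1 : B * (n * E + 1) + 1 ≤ (B + 1) * (n * E + 1) := by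
      rw [add_mul]; omega
    calc (B * (n * E + 1) + 1) ^ n ≤ ((B + 1) * (n * E + 1)) ^ n := Nat.pow_le_pow_left h1 n
      _ = (B + 1) ^ n * B := by rw [mul_pow, hB]
      _ < (B + 1) ^ n * (B + 1) := by gcongr; omega
      _ = _ := by simp
  obtain ⟨c, hc0, hc⟩ := exists_linear_relation F hF hcard
  let coeffPoly : Fin (B + 1) → MvPolynomial (Fin n) ℝ := fun b =>
    ∑ e : Fin n → Fin (B + 1),
      monomial (Finsupp.equivFunOnFinite.symm fun j => (e j : ℕ)) (c (e, b))
  obtain ⟨⟨e₀, b₀⟩, he⟩ := Function.ne_iff.mp hc0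
  have hinj : ∀ e : Fin n → Fin (B + 1),
      (Finsupp.equivFunOnFinite.symm fun j => (e j : ℕ)) =
        (Finsupp.equivFunOnFinite.symm fun j => (e₀ j : ℕ)) ↔ e = e₀ := by
    intro e
    rw [Equiv.apply_eq_iff_eq]
    refine ⟨fun h => _root_.funext fun j => Fin.ext (congrFun h j), fun h => by rw [h]⟩
  refine ⟨coeffPoly b₀, fun h => he ?_, fun a ha S hS => ?_⟩
  · have := congrArg (coeff (Finsupp.equivFunOnFinite.symm fun j => (e₀ j : ℕ))) h
    simpa [coeffPoly, coeff_sum, coeff_monomial, hinj] using this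
  · let r : Polynomial ℝ := ∑ b : Fin (B + 1), Polynomial.monomial (b : ℕ) (eval a (coeffPoly b))
    have hr : r ≠ 0 := by
      intro h
      have := congrArg (Polynomial.coeff · (b₀ : ℕ)) h
      simp only [r, Polynomial.finsetSum_coeff, Polynomial.coeff_monomial, Fin.val_inj,
        Polynomial.coeff_zero] at this
      exact ha (by simpa using this)
    have hdeg : r.natDegree ≤ B :=
      Polynomial.natDegree_sum_le_of_forall_le _ _ fun b _ =>
        (Polynomial.natDegree_monomial_le _).trans (Nat.lt_succ_iff.mp b.2)
    refine (Polynomial.card_le_degree_of_subset_roots (p := r) fun z hz => ?_).trans hdeg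
    obtain ⟨x, hx, rfl⟩ := Finset.mem_image.mp (Finset.mem_val.mp hz)
    obtain ⟨hPx, hgx⟩ := hS x hx
    rw [Polynomial.mem_roots hr, Polynomial.IsRoot.def]
    have hrel := congrArg (eval x) hc
    have hFx : ∀ s, eval x (F s) =
        (∏ i, a i ^ (s.1 i : ℕ)) * (eval x P ^ B) ^ n * eval x l ^ (s.2 : ℕ) := by
      intro s
      have hfac : ∀ i, eval x (g i ^ (s.1 i : ℕ) * P ^ (B - (s.1 i : ℕ))) =
          a i ^ (s.1 i : ℕ) * eval x P ^ B := by
        intro i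
        have hi : (s.1 i : ℕ) ≤ B := Nat.lt_succ_iff.mp (s.1 i).2
        rw [map_mul, map_pow, map_pow, hgx i, mul_pow, mul_assoc, ← pow_add,
          Nat.add_sub_cancel' hi]
      simp only [F]
      rw [map_mul, map_prod, Finset.prod_congr rfl fun i _ => hfac i, Finset.prod_mul_distrib,
        Finset.prod_const, Finset.card_univ, Fintype.card_fin, map_pow]
    have hne : (eval x P ^ B) ^ n ≠ 0 := pow_ne_zero _ (pow_ne_zero _ hPx)
    refine (mul_eq_zero.mp ?_).resolve_left hne
    rw [← map_zero (eval x), ← hrel, map_sum, Fintype.sum_prod_type_right]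
    simp only [r, Polynomial.eval_finsetSum, Polynomial.eval_monomial, coeffPoly, map_sum,
      eval_monomial, Finset.mul_sum, smul_eval, hFx]
    refine Finset.sum_congr rfl fun b _ => Finset.sum_congr rfl fun e _ => ?_
    rw [Finsupp.prod_fintype _ _ (by simp)]
    simp only [Finsupp.equivFunOnFinite_symm_apply_apply]
    ring

/-- Finitely many points are separated by a linear form from the moment curve whose parameter is
a bounded natural number. -/
theorem exists_moment_form_injective {n M : ℕ} (x : Fin M → Fin n → ℝ)
    (hx : Function.Injective x) :
    ∃ k ∈ Finset.range (M * M * n + 1),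
      Function.Injective fun j => ∑ i, x j i * (k : ℝ) ^ (i : ℕ) := by
  let r : Fin M × Fin M → Polynomial ℝ := fun s =>
    ∑ i : Fin n, Polynomial.monomial (i : ℕ) (x s.1 i - x s.2 i)
  have hr : ∀ s ∈ (Finset.univ : Finset (Fin M)).offDiag, r s ≠ 0 := by
    intro s hs h
    refine (Finset.mem_offDiag.mp hs).2.2 (hx (_root_.funext fun i => ?_))
    have := congrArg (Polynomial.coeff · (i : ℕ)) h
    simp only [r, Polynomial.finsetSum_coeff, Polynomial.coeff_monomial, Fin.val_inj,
      Polynomial.coeff_zero] at this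
    exact sub_eq_zero.mp (by simpa using this)
  have hdeg : (∏ s ∈ (Finset.univ : Finset (Fin M)).offDiag, r s).natDegree ≤ M * M * n := by
    refine (Polynomial.natDegree_prod_le _ _).trans ?_
    refine (Finset.sum_le_card_nsmul _ _ n fun s _ => ?_).trans ?_
    · exact Polynomial.natDegree_sum_le_of_forall_le _ _ fun i _ =>
        (Polynomial.natDegree_monomial_le _).trans i.2.le
    · rw [Finset.offDiag_card, smul_eq_mul]
      refine Nat.mul_le_mul_right _ ?_
      simp
  have hne : (∏ s ∈ (Finset.univ : Finset (Fin M)).offDiag, r s) ≠ 0 :=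
    Finset.prod_ne_zero_iff.mpr hr
  obtain ⟨k, hk, hk0⟩ : ∃ k ∈ Finset.range (M * M * n + 1),
      (∏ s ∈ (Finset.univ : Finset (Fin M)).offDiag, r s).eval (k : ℝ) ≠ 0 := by
    by_contra! h
    have hle := Polynomial.card_le_degree_of_subset_roots
      (p := ∏ s ∈ (Finset.univ : Finset (Fin M)).offDiag, r s)
      (Z := (Finset.range (M * M * n + 1)).image (Nat.cast : ℕ → ℝ)) (fun z hz => by
        obtain ⟨k, hk, rfl⟩ := Finset.mem_image.mp (Finset.mem_val.mp hz)
        exact (Polynomial.mem_roots hne).mpr (h k hk))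
    rw [Finset.card_image_of_injective _ Nat.cast_injective, Finset.card_range] at hle
    omega
  refine ⟨k, hk, fun j j' hjj => ?_⟩
  by_contra hne'
  rw [Polynomial.eval_prod] at hk0
  refine Finset.prod_ne_zero_iff.mp hk0 (j, j') (by simpa using hne') ?_
  simp only [r, Polynomial.eval_finsetSum, Polynomial.eval_monomial, sub_mul,
    Finset.sum_sub_distrib]
  exact sub_eq_zero.mpr hjj

/-- If the rational map `g / P` takes every value at `M` distinct points at least, then `M` is
bounded in terms of the degrees. -/
theorem card_le_of_forall_exists_solutions {n E M : ℕ} (g : Fin n → MvPolynomial (Fin n) ℝ)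
    (P : MvPolynomial (Fin n) ℝ) (hg : ∀ i, (g i).totalDegree ≤ E) (hP : P.totalDegree ≤ E)
    (hsol : ∀ a : Fin n → ℝ, ∃ x : Fin M → Fin n → ℝ, Function.Injective x ∧
      ∀ j, eval (x j) P ≠ 0 ∧ ∀ i, eval (x j) (g i) = a i * eval (x j) P) :
    M ≤ (n * E + 1) ^ n := by
  let l : ℕ → MvPolynomial (Fin n) ℝ := fun k => ∑ i : Fin n, C ((k : ℝ) ^ (i : ℕ)) * X i
  have hl : ∀ k, (l k).totalDegree ≤ 1 := fun k =>
    totalDegree_finsetSum_le fun i _ =>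
      (totalDegree_mul _ _).trans (by rw [totalDegree_C, totalDegree_X])
  choose q hq0 hq using fun k => exists_ne_zero_card_image_le g P (l k) hg hP (hl k)
  have hprod : (∏ k ∈ Finset.range (M * M * n + 1), q k) ≠ 0 :=
    Finset.prod_ne_zero_iff.mpr fun k _ => hq0 k
  obtain ⟨a, ha⟩ : ∃ a, eval a (∏ k ∈ Finset.range (M * M * n + 1), q k) ≠ 0 := by
    by_contra! h
    exact hprod (MvPolynomial.funext fun a => by rw [h a, map_zero])
  rw [map_prod, Finset.prod_ne_zero_iff] at ha
  obtain ⟨x, hx, hsolx⟩ := hsol a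
  obtain ⟨k, hk, hinj⟩ := exists_moment_form_injective x hx
  have hlx : ∀ y, eval y (l k) = ∑ i, y i * (k : ℝ) ^ (i : ℕ) := fun y => by
    simp [l, mul_comm]
  have hcard := hq k a (ha k hk) (Finset.univ.image x) (by
    intro y hy
    obtain ⟨j, -, rfl⟩ := Finset.mem_image.mp hy
    exact hsolx j)
  rw [Finset.image_image, Finset.card_image_of_injective] at hcard
  · simpa using hcard
  · simpa only [Function.comp_def, hlx] using hinj

theorem tendsto_sq_eval_mul_exp_neg {n : ℕ} (p : MvPolynomial (Fin n) ℝ) (a : Fin n → ℝ) :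
    Filter.Tendsto
      (fun x => eval x p ^ 2 * Real.exp (-∑ i, (x i ^ 2 + 2 * a i * x i)))
      (Filter.cocompact (Fin n → ℝ)) (nhds 0) := by
  obtain ⟨A, k, hA, hp⟩ := exists_abs_eval_le p
  set c := ∑ i, (|a i| + 1) ^ 2 with hc
  have hnorm : ∀ x : Fin n → ℝ, ‖x‖ ≤ ∑ i, (x i ^ 2 + 2 * a i * x i) + c := by
    intro x
    rw [hc, ← Finset.sum_add_distrib]
    have hterm : ∀ i, |x i| ≤ x i ^ 2 + 2 * a i * x i + (|a i| + 1) ^ 2 := by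
      intro i
      have h1 : -(|a i| * |x i|) ≤ a i * x i := by
        rw [← abs_mul]; exact neg_abs_le _
      nlinarith [sq_nonneg (|x i| - |a i| - 1 / 2), sq_abs (x i), sq_abs (a i), abs_nonneg (a i)]
    have hnn : ∀ i, 0 ≤ x i ^ 2 + 2 * a i * x i + (|a i| + 1) ^ 2 := fun i =>
      (abs_nonneg _).trans (hterm i)
    refine (pi_norm_le_iff_of_nonneg (Finset.sum_nonneg fun i _ => hnn i)).mpr fun i => ?_
    exact (hterm i).trans (Finset.single_le_sum
      (f := fun i => x i ^ 2 + 2 * a i * x i + (|a i| + 1) ^ 2) (fun i _ => hnn i)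
      (Finset.mem_univ i))
  have hlim : Filter.Tendsto
      (fun x : Fin n → ℝ => A ^ 2 * Real.exp (c + 1) *
        ((1 + ‖x‖) ^ (2 * k) * Real.exp (-(1 + ‖x‖))))
      (Filter.cocompact (Fin n → ℝ)) (nhds 0) := by
    have h1 : Filter.Tendsto (fun x : Fin n → ℝ => 1 + ‖x‖) (Filter.cocompact _) Filter.atTop :=
      Filter.tendsto_atTop_add_const_left _ _ (tendsto_norm_cocompact_atTop)
    simpa using
      ((Real.tendsto_pow_mul_exp_neg_atTop_nhds_zero (2 * k)).comp h1).const_mul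
        (A ^ 2 * Real.exp (c + 1))
  refine squeeze_zero (fun x => by positivity) (fun x => ?_) hlim
  have h1 : eval x p ^ 2 ≤ (A * (1 + ‖x‖) ^ k) ^ 2 := by
    rw [← sq_abs]; gcongr; exact hp x
  calc eval x p ^ 2 * Real.exp (-∑ i, (x i ^ 2 + 2 * a i * x i))
      ≤ (A * (1 + ‖x‖) ^ k) ^ 2 * Real.exp (c + 1 + -(1 + ‖x‖)) := by
        gcongr; linarith [hnorm x]
    _ = _ := by rw [Real.exp_add]; ring

/-- In every region cut out by the signs of the `f i`, the logarithmic gradient of `∏ i, f i`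
minus the identity takes every value. -/
theorem exists_logDeriv_eq {n : ℕ} {ι : Type*} [Fintype ι] (f : ι → MvPolynomial (Fin n) ℝ)
    (y : Fin n → ℝ) (hy : ∀ i, eval y (f i) ≠ 0) (a : Fin n → ℝ) :
    ∃ x : Fin n → ℝ, (∀ i, 0 < eval x (f i) * eval y (f i)) ∧
      ∀ i, eval x (pderiv i (∏ j, f j) - X i * ∏ j, f j) = a i * eval x (∏ j, f j) := by
  set P := ∏ j, f j with hP
  let w : MvPolynomial (Fin n) ℝ := ∑ i, (X i ^ 2 + C (2 * a i) * X i)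
  have hw : ∀ x, eval x w = ∑ i, (x i ^ 2 + 2 * a i * x i) := fun x => by simp [w]
  let h : (Fin n → ℝ) → ℝ := fun x => eval x P ^ 2 * Real.exp (-eval x w)
  have hcont : Continuous h := by
    have h1 := MvPolynomial.continuous_eval P
    have h2 := MvPolynomial.continuous_eval w
    exact (h1.pow 2).mul (Real.continuous_exp.comp h2.neg)
  have hPy : eval y P ≠ 0 := by
    rw [hP, map_prod]; exact Finset.prod_ne_zero_iff.mpr fun i _ => hy i
  have hhy : 0 < h y := by positivity
  have hlim : Filter.Tendsto h (Filter.cocompact _) (nhds 0) := by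
    simpa only [h, hw] using tendsto_sq_eval_mul_exp_neg P a
  let F : Set (Fin n → ℝ) := {x | ∀ i, 0 ≤ eval x (f i) * eval y (f i)}
  have hF : IsClosed F := by
    simp only [F, Set.ofPred_forall]
    exact isClosed_iInter fun i =>
      isClosed_le continuous_const ((MvPolynomial.continuous_eval (f i)).mul continuous_const)
  obtain ⟨x, hxF, hmax⟩ := hcont.continuousOn.exists_isMaxOn' hF
    (show y ∈ F from fun i => mul_self_nonneg _)
    (((hlim.eventually_lt_const hhy).mono fun _ h => h.le).filter_mono inf_le_left)
  have hhx : 0 < h x := hhy.trans_le (hmax (show y ∈ F from fun i => mul_self_nonneg _))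
  have hPx : eval x P ≠ 0 := by
    intro h0
    simp [h, h0] at hhx
  have hfx : ∀ i, 0 < eval x (f i) * eval y (f i) := by
    intro i
    rw [hP, map_prod, Finset.prod_ne_zero_iff] at hPx
    exact (hxF i).lt_of_ne (mul_ne_zero (hPx i (Finset.mem_univ i)) (hy i)).symm
  refine ⟨x, hfx, fun i => ?_⟩
  have hFnhds : F ∈ nhds x := by
    have : ∀ᶠ z in nhds x, ∀ i, 0 < eval z (f i) * eval y (f i) :=
      Filter.eventually_all.mpr fun i =>
        ((MvPolynomial.continuous_eval (f i)).mul continuous_const).continuousAt.eventually_const_lt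
          (hfx i)
    exact this.mono fun z hz i => (hz i).le
  have hloc : IsLocalMax h (Function.update x i (x i)) := by
    rw [Function.update_eq_self]; exact hmax.isLocalMax hFnhds
  have hloc' : IsLocalMax (fun t => h (Function.update x i t)) (x i) :=
    hloc.comp_continuous (g := Function.update x i)
      (continuous_const.update i continuous_id).continuousAt
  have hd := ((hasDerivAt_eval_update_s8 P x i (x i)).pow 2).mul
    ((hasDerivAt_eval_update_s8 w x i (x i)).neg.exp)
  have hzero := hloc'.hasDerivAt_eq_zero hd
  have hwi : eval x (pderiv i w) = 2 * x i + 2 * a i := by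
    simp [w, pderiv_X, Pi.single_apply, Finset.sum_add_distrib]
  simp only [Function.update_eq_self, hwi] at hzero
  have hfac : 2 * eval x P * Real.exp (-eval x w) *
      (eval x (pderiv i P) - (x i + a i) * eval x P) = 0 := by
    simp at hzero
    linear_combination hzero
  have hne : 2 * eval x P * Real.exp (-eval x w) ≠ 0 := by positivity
  have := (mul_eq_zero.mp hfac).resolve_left hne
  rw [map_sub, map_mul, eval_X]
  linear_combination this

/-- A bound on the number of strict sign patterns of finitely many polynomials. -/
theorem card_le_of_sign_patterns {n d M : ℕ} {ι : Type*} [Fintype ι]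
    (f : ι → MvPolynomial (Fin n) ℝ) (hf : ∀ i, (f i).totalDegree ≤ d)
    (y : Fin M → Fin n → ℝ) (hy : ∀ j i, eval (y j) (f i) ≠ 0)
    (hsep : ∀ j j', j ≠ j' → ∃ i, eval (y j) (f i) * eval (y j') (f i) < 0) :
    M ≤ (n * (Fintype.card ι * d + 1) + 1) ^ n := by
  have hP : (∏ j, f j).totalDegree ≤ Fintype.card ι * d :=
    (totalDegree_finsetProd _ _).trans
      ((Finset.sum_le_card_nsmul _ _ d fun i _ => hf i).trans (by simp))
  refine card_le_of_forall_exists_solutions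
    (fun i => pderiv i (∏ j, f j) - X i * ∏ j, f j) (∏ j, f j) (fun i => ?_)
    (hP.trans (Nat.le_succ _)) fun a => ?_
  · refine (totalDegree_sub _ _).trans (max_le ?_ ?_)
    · exact ((totalDegree_pderiv_le _ _).trans hP).trans (Nat.le_succ _)
    · refine (totalDegree_mul _ _).trans ?_
      rw [totalDegree_X]
      omega
  · choose x hx hxa using fun j => exists_logDeriv_eq f (y j) (hy j) a
    refine ⟨x, fun j j' hjj => ?_, fun j => ⟨?_, hxa j⟩⟩
    · by_contra hne
      obtain ⟨i, hi⟩ := hsep j j' hne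
      have h1 := hx j i
      have h2 := hx j' i
      rw [← hjj] at h2
      nlinarith [mul_pos h1 h2, mul_nonneg (sq_nonneg (eval (x j) (f i))) (neg_nonneg.mpr hi.le)]
    · rw [map_prod, Finset.prod_ne_zero_iff]
      exact fun i _ h0 => by simpa [h0] using hx j i

end MvPolynomial

/-- The part of a polynomial image inside a cube is covered, in the sup norm, by few cubes centred
on the image. -/
theorem exists_finset_cover_polyImage {n N d : ℕ} (P : Fin N → MvPolynomial (Fin n) ℝ)
    (hP : ∀ i, (P i).totalDegree ≤ d) (c : Fin N → ℝ) {s : ℝ} (hs : 0 < s) (K : ℕ) :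
    ∃ Y : Finset (Fin n → ℝ), Y.card ≤ (n * (N * (2 * K + 1) * d + 1) + 1) ^ n ∧
      ∀ z : Fin n → ℝ, (∀ i, |MvPolynomial.eval z (P i) - c i| ≤ K * s) →
        ∃ y ∈ Y, ∀ i, |MvPolynomial.eval z (P i) - MvPolynomial.eval y (P i)| ≤ s := by
  let cell : (Fin n → ℝ) → Fin N → ℤ := fun z i => ⌊(MvPolynomial.eval z (P i) - c i) / s⌋
  let S : Set (Fin n → ℝ) := {z | ∀ i, |MvPolynomial.eval z (P i) - c i| ≤ K * s}
  have hcell : ∀ z ∈ S, ∀ i, cell z i ∈ Finset.Icc (-(K : ℤ)) K := by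
    intro z hz i
    obtain ⟨h1, h2⟩ := abs_le.mp (hz i)
    rw [Finset.mem_Icc]
    constructor
    · refine Int.le_floor.mpr ?_
      rw [le_div_iff₀ hs]; push_cast; linarith
    · have : (cell z i : ℝ) ≤ K := (Int.floor_le _).trans (by rwa [div_le_iff₀ hs])
      exact_mod_cast this
  have hfin : (cell '' S).Finite := by
    refine (Set.finite_Icc (fun _ : Fin N => -(K : ℤ)) (fun _ => (K : ℤ))).subset ?_
    rintro _ ⟨z, hz, rfl⟩
    exact ⟨fun i => (Finset.mem_Icc.mp (hcell z hz i)).1,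
      fun i => (Finset.mem_Icc.mp (hcell z hz i)).2⟩
  obtain ⟨R, hRS, hbij⟩ := Set.exists_subset_bijOn S cell
  have hR : R.Finite := Set.Finite.of_finite_image (hbij.image_eq ▸ hfin) hbij.injOn
  refine ⟨hR.toFinset, ?_, fun z hz => ?_⟩
  · let y : Fin hR.toFinset.card → Fin n → ℝ := fun j => (hR.toFinset.equivFin.symm j : Fin n → ℝ)
    have hyR : ∀ j, y j ∈ R := fun j => hR.mem_toFinset.mp (hR.toFinset.equivFin.symm j).2
    have hyinj : Function.Injective y :=
      Subtype.val_injective.comp hR.toFinset.equivFin.symm.injective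
    -- A small shift of the grid moves all representatives off the grid hyperplanes.
    obtain ⟨δ, hδpos, hδ⟩ : ∃ δ : ℝ, 0 < δ ∧
        ∀ (j : Fin hR.toFinset.card) (i : Fin N) (k : Finset.Icc (-(K : ℤ)) K),
          MvPolynomial.eval (y j) (P i) - (c i + s * (k : ℤ)) < 0 →
          MvPolynomial.eval (y j) (P i) - (c i + s * (k : ℤ)) + δ < 0 := by
      have hev : ∀ᶠ δ : ℝ in nhdsWithin 0 (Set.Ioi 0),
          ∀ (j : Fin hR.toFinset.card) (i : Fin N) (k : Finset.Icc (-(K : ℤ)) K),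
          MvPolynomial.eval (y j) (P i) - (c i + s * (k : ℤ)) < 0 →
          MvPolynomial.eval (y j) (P i) - (c i + s * (k : ℤ)) + δ < 0 := by
        refine nhdsWithin_le_nhds ?_
        refine Filter.eventually_all.mpr fun j => Filter.eventually_all.mpr fun i =>
          Filter.eventually_all.mpr fun k => ?_
        by_cases h : MvPolynomial.eval (y j) (P i) - (c i + s * (k : ℤ)) < 0
        · filter_upwards [gt_mem_nhds (neg_pos.mpr h)] with δ hδ _
          linarith
        · exact Filter.Eventually.of_forall fun δ h' => absurd h' h
      obtain ⟨δ, hδ, hpos⟩ := (hev.and self_mem_nhdsWithin).exists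
      exact ⟨δ, hpos, hδ⟩
    let f : Fin N × Finset.Icc (-(K : ℤ)) K → MvPolynomial (Fin n) ℝ := fun r =>
      P r.1 - MvPolynomial.C (c r.1 + s * (r.2 : ℤ) - δ)
    have hfe : ∀ x r, MvPolynomial.eval x (f r) =
        MvPolynomial.eval x (P r.1) - (c r.1 + s * (r.2 : ℤ)) + δ := fun x r => by
      simp only [f, map_sub, MvPolynomial.eval_C]; ring
    have hpos : ∀ j i (k : Finset.Icc (-(K : ℤ)) K), (k : ℤ) ≤ cell (y j) i →
        0 < MvPolynomial.eval (y j) (f (i, k)) := by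
      intro j i k h
      have := Int.le_floor.mp h
      rw [le_div_iff₀ hs] at this
      rw [hfe]; dsimp only; linarith
    have hneg : ∀ j i (k : Finset.Icc (-(K : ℤ)) K), cell (y j) i < (k : ℤ) →
        MvPolynomial.eval (y j) (f (i, k)) < 0 := by
      intro j i k h
      have := Int.floor_lt.mp h
      rw [div_lt_iff₀ hs] at this
      rw [hfe]
      exact hδ j i k (by linarith)
    have hmain := MvPolynomial.card_le_of_sign_patterns (d := d) f
      (fun r => (MvPolynomial.totalDegree_sub_C_le _ _).trans (hP r.1)) y
      (fun j r => (le_or_gt (r.2 : ℤ) (cell (y j) r.1)).elim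
        (fun h => (hpos j r.1 r.2 h).ne') (fun h => (hneg j r.1 r.2 h).ne))
      (fun j j' hjj => by
        have hne : cell (y j) ≠ cell (y j') := fun h =>
          hjj (hyinj (hbij.injOn (hyR j) (hyR j') h))
        obtain ⟨i, hi⟩ := Function.ne_iff.mp hne
        rcases lt_or_gt_of_ne hi with h | h
        · let k : Finset.Icc (-(K : ℤ)) K := ⟨_, hcell (y j') (hRS (hyR j')) i⟩
          exact ⟨(i, k), mul_neg_of_neg_of_pos (hneg j i k h) (hpos j' i k le_rfl)⟩
        · let k : Finset.Icc (-(K : ℤ)) K := ⟨_, hcell (y j) (hRS (hyR j)) i⟩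
          exact ⟨(i, k), mul_neg_of_pos_of_neg (hpos j i k le_rfl) (hneg j' i k h)⟩)
    have hcard : Fintype.card (Fin N × Finset.Icc (-(K : ℤ)) K) = N * (2 * K + 1) := by
      rw [Fintype.card_prod, Fintype.card_fin, Fintype.card_coe, Int.card_Icc]
      congr 1; omega
    rwa [hcard] at hmain
  · obtain ⟨y, hy, hyz⟩ := hbij.surjOn ⟨z, hz, rfl⟩
    refine ⟨y, hR.mem_toFinset.mpr hy, fun i => ?_⟩
    have := (Int.abs_sub_lt_one_of_floor_eq_floor (congrFun hyz i)).le
    rw [← sub_div, abs_div, abs_of_pos hs, div_le_one hs, abs_sub_comm] at this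
    simpa using this

theorem norm_le_card_mul_of_abs_le {N : ℕ} (v : EuclideanSpace ℝ (Fin N)) {s : ℝ}
    (hv : ∀ i, |v i| ≤ s) : ‖v‖ ≤ N * s := by
  calc ‖v‖ = ‖∑ i, EuclideanSpace.single i (v i)‖ := by
        congr 1; ext j; simp [Pi.single_apply]
    _ ≤ ∑ i, ‖EuclideanSpace.single i (v i)‖ := norm_sum_le _ _
    _ = ∑ i, |v i| := by simp
    _ ≤ ∑ _i : Fin N, s := Finset.sum_le_sum fun i _ => hv i
    _ = N * s := by simp

/-- The tube of radius `ε` around a polynomial image, inside a ball of radius `σ ≥ ε`, is covered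
by few balls of radius `2ε`. -/
theorem exists_finset_cover_tube {n N d : ℕ} (hN : 1 ≤ N) (P : Fin N → MvPolynomial (Fin n) ℝ)
    (hP : ∀ i, (P i).totalDegree ≤ d) (pbar : EuclideanSpace ℝ (Fin N)) {σ ε : ℝ}
    (hε : 0 < ε) (hεσ : ε ≤ σ) :
    ∃ Y : Finset (Fin n → ℝ),
      Y.card ≤ (n * (N * (2 * ⌈6 * N * (σ / ε)⌉₊ + 1) * d + 1) + 1) ^ n ∧
      {x | Metric.infDist x (Set.range (polyMap P)) ≤ ε} ∩ Metric.closedBall pbar σ ⊆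
        ⋃ y ∈ Y, Metric.closedBall (polyMap P y) (2 * ε) := by
  have hN0 : (0 : ℝ) < N := by exact_mod_cast hN
  have hs : 0 < ε / (2 * N) := by positivity
  obtain ⟨Y, hY, hcov⟩ :=
    exists_finset_cover_polyImage P hP (fun i => pbar i) hs ⌈6 * N * (σ / ε)⌉₊
  refine ⟨Y, hY, ?_⟩
  rintro x ⟨hx, hxσ⟩
  have hx' : Metric.infDist x (Set.range (polyMap P)) < 3 / 2 * ε :=
    lt_of_le_of_lt hx (by linarith)
  obtain ⟨_, ⟨z, rfl⟩, hz⟩ := (Metric.infDist_lt_iff (Set.range_nonempty _)).mp hx'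
  have hzσ : ‖polyMap P z - pbar‖ ≤ 3 * σ := by
    rw [← dist_eq_norm]
    have := dist_triangle_left (polyMap P z) pbar x
    rw [Metric.mem_closedBall] at hxσ
    linarith
  obtain ⟨y, hyY, hy⟩ := hcov z (fun i => by
    have h1 : |(polyMap P z - pbar) i| ≤ ‖polyMap P z - pbar‖ := by
      rw [← Real.norm_eq_abs]; exact PiLp.norm_apply_le _ i
    have h2 : 3 * σ ≤ ⌈6 * N * (σ / ε)⌉₊ * (ε / (2 * N)) := by
      calc 3 * σ = 6 * N * (σ / ε) * (ε / (2 * N)) := by field_simp; ring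
        _ ≤ _ := by gcongr; exact Nat.le_ceil _
    exact (h1.trans hzσ).trans h2)
  refine Set.mem_biUnion hyY ?_
  have hzy : ‖polyMap P z - polyMap P y‖ ≤ ε / 2 := by
    refine (norm_le_card_mul_of_abs_le _ hy).trans_eq ?_
    field_simp
  rw [← dist_eq_norm] at hzy
  rw [Metric.mem_closedBall]
  linarith [dist_triangle x (polyMap P z) (polyMap P y)]

theorem covering_count_le {n N d M : ℕ} (hn : 1 ≤ n) (hnN : n ≤ N) (hd : 2 ≤ d) {t : ℝ}
    (ht : 1 ≤ t) (hM : M ≤ (n * (N * (2 * ⌈6 * N * t⌉₊ + 1) * d + 1) + 1) ^ n) :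
    (M : ℝ) ≤ t ^ n * (d : ℝ) ^ (6 * n) * (N : ℝ) ^ (6 * n) := by
  have hn' : (1 : ℝ) ≤ n := by exact_mod_cast hn
  have hnN' : (n : ℝ) ≤ N := by exact_mod_cast hnN
  have hN' : (1 : ℝ) ≤ N := hn'.trans hnN'
  have hd' : (2 : ℝ) ≤ d := by exact_mod_cast hd
  have hceil : (⌈6 * N * t⌉₊ : ℝ) ≤ 6 * N * t + 1 := (Nat.ceil_lt_add_one (by positivity)).le
  have hNt : 1 ≤ N * t := one_le_mul_of_one_le_of_one_le hN' ht
  have h1 : (N : ℝ) * (2 * ⌈6 * N * t⌉₊ + 1) * d + 1 ≤ 16 * (N ^ 2 * t * d) := by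
    have ha : (2 * ⌈6 * N * t⌉₊ + 1 : ℝ) ≤ 15 * (N * t) := by linarith
    have hb : (N : ℝ) * (2 * ⌈6 * N * t⌉₊ + 1) * d ≤ N * (15 * (N * t)) * d := by gcongr
    have hc : 1 ≤ N * (N * t) * d :=
      one_le_mul_of_one_le_of_one_le (one_le_mul_of_one_le_of_one_le hN' hNt) (by linarith)
    nlinarith
  have h2 : (n : ℝ) * (N * (2 * ⌈6 * N * t⌉₊ + 1) * d + 1) + 1 ≤ t * d ^ 6 * N ^ 6 := by
    have ha : (n : ℝ) * (N * (2 * ⌈6 * N * t⌉₊ + 1) * d + 1) ≤ N * (16 * (N ^ 2 * t * d)) := by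
      gcongr
    have hb : 1 ≤ (N : ℝ) ^ 3 * t * d :=
      one_le_mul_of_one_le_of_one_le
        (one_le_mul_of_one_le_of_one_le (one_le_pow₀ hN') ht) (by linarith)
    have hc : (32 : ℝ) ≤ d ^ 5 := by
      calc (32 : ℝ) = 2 ^ 5 := by norm_num
        _ ≤ d ^ 5 := by gcongr
    calc _ ≤ 32 * ((N : ℝ) ^ 3 * t * d) := by nlinarith
      _ ≤ d ^ 5 * ((N : ℝ) ^ 6 * t * d) := by
        gcongr
        norm_num
      _ = _ := by ring
  calc (M : ℝ) ≤ ((n : ℝ) * (N * (2 * ⌈6 * N * t⌉₊ + 1) * d + 1) + 1) ^ n := by exact_mod_cast hM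
    _ ≤ (t * d ^ 6 * N ^ 6) ^ n := by gcongr
    _ = _ := by rw [mul_pow, mul_pow, ← pow_mul, ← pow_mul]

/-- There is an absolute constant `C > 0` such that for every polynomial map
`p : ℝ^n → ℝ^N` of degree at most `d` (with `1 ≤ n ≤ N`, `d ≥ 2`), every center
`p̄`, radius `σ > 0`, and `0 < ε ≤ σ`, a uniformly random point of the closed ball
`B(p̄, σ)` is within distance `ε` of `im(p)` with probability at most
`(ε/σ)^(N−n)·2^N·d^(Cn)·N^(Cn)`. -/
theorem prob_close_to_polyImage : ∃ C : ℝ, 0 < C ∧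
    ∀ (n N d : ℕ), 1 ≤ n → n ≤ N → 2 ≤ d →
    ∀ (P : Fin N → MvPolynomial (Fin n) ℝ), (∀ i, (P i).totalDegree ≤ d) →
    ∀ (pbar : EuclideanSpace ℝ (Fin N)) (σ ε : ℝ), 0 < σ → 0 < ε → ε ≤ σ →
    ((volume (Metric.closedBall pbar σ))⁻¹
        • volume.restrict (Metric.closedBall pbar σ))
      {x : EuclideanSpace ℝ (Fin N) | Metric.infDist x (Set.range (polyMap P)) ≤ ε}
      ≤ ENNReal.ofReal
          ((ε / σ) ^ (N - n) * 2 ^ N * (d : ℝ) ^ (C * n) * (N : ℝ) ^ (C * n)) := by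
  refine ⟨6, by norm_num, fun n N d hn hnN hd P hP pbar σ ε hσ hε hεσ => ?_⟩
  have hN : 1 ≤ N := hn.trans hnN
  obtain ⟨Y, hYcard, hYcov⟩ := exists_finset_cover_tube hN P hP pbar hε hεσ
  have hY := covering_count_le hn hnN hd ((one_le_div hε).mpr hεσ) hYcard
  set S := {x : EuclideanSpace ℝ (Fin N) | Metric.infDist x (Set.range (polyMap P)) ≤ ε}
  have hfr : Module.finrank ℝ (EuclideanSpace ℝ (Fin N)) = N := by simp
  have hratio : ∀ y : EuclideanSpace ℝ (Fin N), volume (Metric.closedBall y (2 * ε)) =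
      ENNReal.ofReal ((2 * ε / σ) ^ N) * volume (Metric.closedBall pbar σ) := by
    intro y
    rw [Measure.addHaar_closedBall _ _ hσ.le, Measure.addHaar_closedBall _ _ (by positivity), hfr,
      ← mul_assoc, ← ENNReal.ofReal_mul (by positivity), ← mul_pow, div_mul_cancel₀ _ hσ.ne']
  have hvol : volume (S ∩ Metric.closedBall pbar σ) ≤
      ENNReal.ofReal (Y.card * (2 * ε / σ) ^ N) * volume (Metric.closedBall pbar σ) := by
    calc volume (S ∩ Metric.closedBall pbar σ)
        ≤ ∑ y ∈ Y, volume (Metric.closedBall (polyMap P y) (2 * ε)) :=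
          (measure_mono hYcov).trans (measure_biUnion_finset_le _ _)
      _ = _ := by
          simp only [hratio, Finset.sum_const, nsmul_eq_mul]
          rw [ENNReal.ofReal_mul (by positivity), ENNReal.ofReal_natCast, mul_assoc]
  have hpos : volume (Metric.closedBall pbar σ) ≠ 0 := (Metric.measure_closedBall_pos _ _ hσ).ne'
  have hfin : volume (Metric.closedBall pbar σ) ≠ ⊤ := measure_closedBall_lt_top.ne
  rw [Measure.smul_apply, smul_eq_mul, Measure.restrict_apply' measurableSet_closedBall]
  calc (volume (Metric.closedBall pbar σ))⁻¹ * volume (S ∩ Metric.closedBall pbar σ)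
      ≤ (volume (Metric.closedBall pbar σ))⁻¹ *
          (ENNReal.ofReal (Y.card * (2 * ε / σ) ^ N) * volume (Metric.closedBall pbar σ)) := by
        gcongr
    _ = ENNReal.ofReal (Y.card * (2 * ε / σ) ^ N) := by
        rw [mul_left_comm, ENNReal.inv_mul_cancel hpos hfin, mul_one]
    _ ≤ _ := by
        refine ENNReal.ofReal_le_ofReal ?_
        have hexp : ∀ x : ℝ, x ^ ((6 : ℝ) * n) = x ^ (6 * n) := fun x => by
          rw [← Real.rpow_natCast]; push_cast; rfl
        rw [hexp, hexp]
        calc (Y.card : ℝ) * (2 * ε / σ) ^ N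
            ≤ ((σ / ε) ^ n * (d : ℝ) ^ (6 * n) * (N : ℝ) ^ (6 * n)) * (2 * ε / σ) ^ N := by
              gcongr
          _ = ((σ / ε) ^ n * (ε / σ) ^ N) * 2 ^ N * (d : ℝ) ^ (6 * n) * (N : ℝ) ^ (6 * n) := by
              rw [mul_div_assoc, mul_pow]; ring
          _ = _ := by
              have hsplit : (σ / ε) ^ n * (ε / σ) ^ N = (ε / σ) ^ (N - n) := by
                rw [← Nat.sub_add_cancel hnN, pow_add, Nat.add_sub_cancel, mul_left_comm,
                  ← mul_pow, div_mul_div_cancel₀ hε.ne', div_self hσ.ne', one_pow, mul_one]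
              rw [hsplit]
end
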